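/- arXiv:2310.05648 — 4 statements merged into one kernel-verified Lean document; each statement's English description precedes it below -/
import Mathlib

section
/- Intermediate bound (Lemma 2.1). Assume the abstract framework and transfer operators satisfying (4), (5) and (6). Then every v ∈ V and every v_M ∈ V_M satisfy |||v − J(I_M(I_h v_M))|||_pw ≤ (1 + Λ_J)·(1 + Λ_M)·(1 + Λ_h)·|||v − v_M|||_pw. -/
theorem sqrt_form_triangle {X : Type*} [AddCommGroup X] [Module ℝ X] (b : X → X → ℝ)
    (hadd : ∀ x y z : X, b (x + y) z = b x z + b y z)
    (hsmul : ∀ (c : ℝ) (x y : X), b (c • x) y = c * b x y)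
    (hsymm : ∀ x y : X, b x y = b y x)
    (hnn : ∀ x : X, 0 ≤ b x x) (x y : X) :
    Real.sqrt (b (x + y) (x + y)) ≤ Real.sqrt (b x x) + Real.sqrt (b y y) := by
  have haddr : ∀ x y z : X, b z (x + y) = b z x + b z y := fun x y z => by
    rw [hsymm, hadd, hsymm x, hsymm y]
  have hsmulr : ∀ (c : ℝ) (x y : X), b x (c • y) = c * b x y := fun c x y => by
    rw [hsymm, hsmul, hsymm y]
  have hq : ∀ t : ℝ, 0 ≤ b y y * (t * t) + (2 * b x y) * t + b x x := fun t => by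
    have h := hnn (x + t • y)
    rw [hadd, haddr, haddr, hsmul, hsmul, hsmulr, hsmulr, hsymm y x] at h
    linarith
  have hd := discrim_le_zero hq
  unfold discrim at hd
  have hcs : b x y ≤ Real.sqrt (b x x) * Real.sqrt (b y y) := by
    rw [← Real.sqrt_mul (hnn x)]
    apply Real.le_sqrt_of_sq_le
    nlinarith
  apply Real.sqrt_le_iff.mpr
  refine ⟨by positivity, ?_⟩
  rw [hadd, haddr, haddr, hsymm y x]
  nlinarith [Real.sq_sqrt (hnn x), Real.sq_sqrt (hnn y)]

/-- **Intermediate bound (Lemma 2.1).**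
Abstract framework: `X` is a real vector space, `apw` and `jh` are symmetric positive
semidefinite bilinear forms, `npw x = sqrt (apw x x)` and `nh x = sqrt (apw x x + jh x x)`,
`V`, `VM`, `Vh` are subspaces and `jh` vanishes on `V + VM`.  Transfer operators
`Ih : VM → Vh`, `IM : X → VM`, `J : VM → V` satisfy (4), (5), (6).  Then every `v ∈ V`
and `vM ∈ VM` satisfy
`|||v − J(IM(Ih vM))|||_pw ≤ (1 + ΛJ)(1 + ΛM)(1 + Λh) |||v − vM|||_pw`. -/
theorem intermediate_bound
    {X : Type*} [AddCommGroup X] [Module ℝ X]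
    (apw jh : X → X → ℝ)
    (hapw_addl : ∀ x y z : X, apw (x + y) z = apw x z + apw y z)
    (hapw_smull : ∀ (c : ℝ) (x y : X), apw (c • x) y = c * apw x y)
    (hapw_symm : ∀ x y : X, apw x y = apw y x)
    (hapw_nonneg : ∀ x : X, 0 ≤ apw x x)
    (hjh_addl : ∀ x y z : X, jh (x + y) z = jh x z + jh y z)
    (hjh_smull : ∀ (c : ℝ) (x y : X), jh (c • x) y = c * jh x y)
    (hjh_symm : ∀ x y : X, jh x y = jh y x)
    (hjh_nonneg : ∀ x : X, 0 ≤ jh x x)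
    (V VM Vh : Submodule ℝ X)
    (hjh_vanish : ∀ v ∈ V ⊔ VM, ∀ w : X, jh v w = 0)
    (npw nh : X → ℝ)
    (hnpw_def : ∀ x : X, npw x = Real.sqrt (apw x x))
    (hnh_def : ∀ x : X, nh x = Real.sqrt (apw x x + jh x x))
    (Ih IM J : X →ₗ[ℝ] X)
    (hIh_maps : ∀ x ∈ VM, Ih x ∈ Vh)
    (hIM_maps : ∀ x : X, IM x ∈ VM)
    (hJ_maps : ∀ x ∈ VM, J x ∈ V)
    (Λh ΛM ΛJ : ℝ)
    (hΛh : 0 ≤ Λh) (hΛM : 0 ≤ ΛM) (hΛJ : 0 ≤ ΛJ)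
    (h4 : ∀ vM ∈ VM, nh (vM - Ih vM) ≤ Λh * ⨅ v : V, npw ((v : X) - vM))
    (h5 : ∀ vh ∈ Vh, nh (vh - IM vh) ≤ ΛM * ⨅ v : V, nh ((v : X) - vh))
    (h6 : ∀ vM ∈ VM, npw (vM - J vM) ≤ ΛJ * ⨅ v : V, npw ((v : X) - vM)) :
    ∀ v ∈ V, ∀ vM ∈ VM,
      npw (v - J (IM (Ih vM))) ≤ (1 + ΛJ) * (1 + ΛM) * (1 + Λh) * npw (v - vM) := by
  intro v hv vM hvM
  have tpw : ∀ x y z : X, npw (x - z) ≤ npw (x - y) + npw (y - z) := fun x y z => by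
    have h := sqrt_form_triangle apw hapw_addl hapw_smull hapw_symm hapw_nonneg (x - y) (y - z)
    rw [sub_add_sub_cancel] at h
    simpa only [hnpw_def] using h
  have th : ∀ x y z : X, nh (x - z) ≤ nh (x - y) + nh (y - z) := fun x y z => by
    have h := sqrt_form_triangle (fun x y => apw x y + jh x y)
      (fun x y z => by simp only [hapw_addl, hjh_addl]; ring)
      (fun c x y => by simp only [hapw_smull, hjh_smull]; ring)
      (fun x y => by simp only [hapw_symm x y, hjh_symm x y])
      (fun x => add_nonneg (hapw_nonneg x) (hjh_nonneg x)) (x - y) (y - z)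
    rw [sub_add_sub_cancel] at h
    simpa only [hnh_def] using h
  have heq : ∀ w ∈ VM, nh (v - w) = npw (v - w) := fun w hw => by
    rw [hnh_def, hnpw_def, hjh_vanish _ (Submodule.sub_mem _
      (Submodule.mem_sup_left hv) (Submodule.mem_sup_right hw)), add_zero]
  have ipw : ∀ w : X, ⨅ u : V, npw ((u : X) - w) ≤ npw (v - w) := fun w =>
    ciInf_le (f := fun u : V => npw ((u : X) - w))
      ⟨0, by rintro _ ⟨u, rfl⟩; simp only [hnpw_def]; positivity⟩ ⟨v, hv⟩
  have ih : ∀ w : X, ⨅ u : V, nh ((u : X) - w) ≤ nh (v - w) := fun w =>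
    ciInf_le (f := fun u : V => nh ((u : X) - w))
      ⟨0, by rintro _ ⟨u, rfl⟩; simp only [hnh_def]; positivity⟩ ⟨v, hv⟩
  have hw := hIM_maps (Ih vM)
  have s1 : npw (v - J (IM (Ih vM))) ≤ (1 + ΛJ) * npw (v - IM (Ih vM)) := by
    have := tpw v (IM (Ih vM)) (J (IM (Ih vM)))
    have := (h6 _ hw).trans (mul_le_mul_of_nonneg_left (ipw _) hΛJ)
    linarith
  have s2 : npw (v - IM (Ih vM)) ≤ (1 + ΛM) * nh (v - Ih vM) := by
    rw [← heq _ hw]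
    have := th v (Ih vM) (IM (Ih vM))
    have := (h5 _ (hIh_maps _ hvM)).trans (mul_le_mul_of_nonneg_left (ih _) hΛM)
    linarith
  have s3 : nh (v - Ih vM) ≤ (1 + Λh) * npw (v - vM) := by
    have := th v vM (Ih vM)
    rw [heq _ hvM] at this
    have := (h4 _ hvM).trans (mul_le_mul_of_nonneg_left (ipw _) hΛh)
    linarith
  calc _ ≤ _ := s1
    _ ≤ (1 + ΛJ) * ((1 + ΛM) * ((1 + Λh) * npw (v - vM))) := by
      refine mul_le_mul_of_nonneg_left (s2.trans ?_) (by linarith)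
      exact mul_le_mul_of_nonneg_left s3 (by linarith)
    _ = _ := by ring
end

section
/- Quasi-best approximation (Theorem 2.1, QO). Assume the abstract framework, the discrete bilinear form hypotheses, that J_h : V_h → V is a linear map with |||J_h v_h|||_pw ≤ κ·‖v_h‖_h for all v_h ∈ V_h for some constant κ ≥ 0, that J_h is a quasi-optimal smoother with constant C_J, and that property (H) holds with constant Λ_H. Then there exists a constant C_qo > 0, depending only on α, M, C_J, Λ_H and κ, such that for every linear functional F : V → ℝ, every u ∈ V with a(u, v) = F(v) for all v ∈ V, and every u_h ∈ V_h with a_h(u_h, v_h) = F(J_h v_h) for all v_h ∈ V_h, one has ‖u − u_h‖_h ≤ C_qo · inf_{v_h ∈ V_h} ‖u − v_h‖_h. -/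
universe u

theorem qba_cs {X : Type u} [AddCommGroup X] [Module ℝ X] (b : X → X → ℝ)
    (hadd : ∀ x y z : X, b (x + y) z = b x z + b y z)
    (hsmul : ∀ (c : ℝ) (x y : X), b (c • x) y = c * b x y)
    (hsymm : ∀ x y : X, b x y = b y x)
    (hpos : ∀ x : X, 0 ≤ b x x) (x y : X) :
    b x y ≤ Real.sqrt (b x x) * Real.sqrt (b y y) := by
  have h : ∀ t : ℝ, 0 ≤ b y y * (t * t) + (2 * b x y) * t + b x x := by
    intro t
    have h1 := hpos (x + t • y)
    rw [hadd, hsmul, hsymm x (x + t • y), hsymm y (x + t • y), hadd, hadd, hsmul, hsmul,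
      hsymm y x] at h1
    linarith
  have hd := discrim_le_zero h
  unfold discrim at hd
  rw [← Real.sqrt_mul (hpos x)]
  apply Real.le_sqrt_of_sq_le
  nlinarith

theorem qba_tri {X : Type u} [AddCommGroup X] [Module ℝ X] (b : X → X → ℝ)
    (hadd : ∀ x y z : X, b (x + y) z = b x z + b y z)
    (hsmul : ∀ (c : ℝ) (x y : X), b (c • x) y = c * b x y)
    (hsymm : ∀ x y : X, b x y = b y x)
    (hpos : ∀ x : X, 0 ≤ b x x) (x y : X) :
    Real.sqrt (b (x + y) (x + y)) ≤ Real.sqrt (b x x) + Real.sqrt (b y y) := by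
  apply Real.sqrt_le_iff.2
  refine ⟨by positivity, ?_⟩
  have hc := qba_cs b hadd hsmul hsymm hpos x y
  rw [hadd, hsymm x (x + y), hsymm y (x + y), hadd, hadd, hsymm y x]
  nlinarith [Real.sq_sqrt (hpos x), Real.sq_sqrt (hpos y)]

/-- **Quasi-best approximation (Theorem 2.1, QO).**
Given constants `0 < α ≤ M`, `CJ, ΛH, κ ≥ 0`, there exists a constant `Cqo > 0`
(depending only on `α, M, CJ, ΛH, κ`) such that for any instance of the abstract
framework with a discrete bilinear form `ah` that is `Vh`-elliptic and bounded with
constants `α, M`, a norm `‖·‖_h` positive definite on `V + Vh`, a linear map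
`Jh : Vh → V` with `|||Jh vh|||_pw ≤ κ ‖vh‖_h` which is a quasi-optimal smoother with
constant `CJ` and satisfies property (H) with constant `ΛH`, every linear functional
`F`, every solution `u ∈ V` of `a(u, ·) = F` and every discrete solution
`u_h ∈ Vh` of `ah(u_h, ·) = F(Jh ·)` satisfy
`‖u − u_h‖_h ≤ Cqo · inf_{vh ∈ Vh} ‖u − vh‖_h`. -/
theorem quasi_best_approximation
    (α M CJ ΛH κ : ℝ)
    (hα : 0 < α) (hαM : α ≤ M) (hCJ : 0 ≤ CJ) (hΛH : 0 ≤ ΛH) (hκ : 0 ≤ κ) :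
    ∃ Cqo : ℝ, 0 < Cqo ∧
      ∀ (X : Type u) [AddCommGroup X] [Module ℝ X]
        (apw jh : X → X → ℝ),
      (∀ x y z : X, apw (x + y) z = apw x z + apw y z) →
      (∀ (c : ℝ) (x y : X), apw (c • x) y = c * apw x y) →
      (∀ x y : X, apw x y = apw y x) →
      (∀ x : X, 0 ≤ apw x x) →
      (∀ x y z : X, jh (x + y) z = jh x z + jh y z) →
      (∀ (c : ℝ) (x y : X), jh (c • x) y = c * jh x y) →
      (∀ x y : X, jh x y = jh y x) →
      (∀ x : X, 0 ≤ jh x x) →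
      ∀ (V VM Vh : Submodule ℝ X),
      (∀ v ∈ V ⊔ VM, ∀ w : X, jh v w = 0) →
      ∀ (npw nh : X → ℝ),
      (∀ x : X, npw x = Real.sqrt (apw x x)) →
      (∀ x : X, nh x = Real.sqrt (apw x x + jh x x)) →
      ∀ (ah : X → X → ℝ),
      (∀ x y z : X, ah (x + y) z = ah x z + ah y z) →
      (∀ (c : ℝ) (x y : X), ah (c • x) y = c * ah x y) →
      (∀ x y z : X, ah x (y + z) = ah x y + ah x z) →
      (∀ (c : ℝ) (x y : X), ah x (c • y) = c * ah x y) →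
      (∀ vh ∈ Vh, α * nh vh ^ 2 ≤ ah vh vh) →
      (∀ vh ∈ Vh, ∀ wh ∈ Vh, ah vh wh ≤ M * nh vh * nh wh) →
      (∀ x ∈ V ⊔ Vh, nh x = 0 → x = 0) →
      ∀ (Jh : X →ₗ[ℝ] X),
      (∀ x ∈ Vh, Jh x ∈ V) →
      (∀ vh ∈ Vh, npw (Jh vh) ≤ κ * nh vh) →
      (∀ vh ∈ Vh, nh (vh - Jh vh) ≤ CJ * ⨅ v : V, nh ((v : X) - vh)) →
      (∀ wh ∈ Vh, ∀ vh ∈ Vh,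
        ah wh vh - apw (Jh wh) (Jh vh) ≤ ΛH * nh (wh - Jh wh) * nh vh) →
      ∀ (F : X →ₗ[ℝ] ℝ) (u u_h : X),
      u ∈ V → (∀ v ∈ V, apw u v = F v) →
      u_h ∈ Vh → (∀ vh ∈ Vh, ah u_h vh = F (Jh vh)) →
      nh (u - u_h) ≤ Cqo * ⨅ vh : Vh, nh (u - (vh : X)) := by
  have hK : 0 ≤ (ΛH * CJ + κ * (1 + CJ)) / α := by positivity
  refine ⟨1 + (ΛH * CJ + κ * (1 + CJ)) / α, by linarith, ?_⟩
  intro X _ _ apw jh a1 a2 a3 a4 j1 j2 j3 j4 V VM Vh hj npw nh hnpw hnh ah b1 b2 b3 b4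
    hell hbd _ Jh hJV hJk hJq hH F u u_h hu hFu huh hFuh
  have hC : 0 ≤ 1 + (ΛH * CJ + κ * (1 + CJ)) / α := by linarith
  have nn : ∀ x, 0 ≤ nh x := fun x => by rw [hnh]; positivity
  have tri : ∀ x y, nh (x + y) ≤ nh x + nh y := by
    intro x y
    rw [hnh, hnh, hnh]
    exact qba_tri (fun x y => apw x y + jh x y)
      (fun x y z => by simp only [a1, j1]; ring)
      (fun c x y => by simp only [a2, j2]; ring)
      (fun x y => by simp only [a3 x y, j3 x y])
      (fun x => add_nonneg (a4 x) (j4 x)) x y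
  have asub : ∀ x y z, apw (x - y) z = apw x z - apw y z := by
    intro x y z
    have := a1 (x - y) y z
    rw [sub_add_cancel] at this
    linarith
  have jneg : ∀ x y, nh (x - y) = nh (y - x) := by
    intro x y
    have e : x - y = (-1 : ℝ) • (y - x) := by simp
    rw [hnh, hnh, e, a2, j2, a3, j3, a2, j2]
    congr 1
    ring
  rw [Real.mul_iInf_of_nonneg hC]
  apply le_ciInf
  rintro ⟨v, hv⟩
  show nh (u - u_h) ≤ _ * nh (u - v)
  have he : v - u_h ∈ Vh := Vh.sub_mem hv huh
  have q1 : nh (v - Jh v) ≤ CJ * nh (u - v) := by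
    refine (hJq v hv).trans (mul_le_mul_of_nonneg_left ?_ hCJ)
    exact ciInf_le ⟨0, by rintro _ ⟨w, rfl⟩; exact nn _⟩ (⟨u, hu⟩ : V)
  have q2 : npw (Jh v - u) ≤ (1 + CJ) * nh (u - v) := by
    have h1 : npw (Jh v - u) ≤ nh (Jh v - u) := by
      rw [hnpw, hnh]
      exact Real.sqrt_le_sqrt (by linarith [j4 (Jh v - u)])
    have h2 := tri (Jh v - v) (v - u)
    rw [sub_add_sub_cancel, jneg (Jh v) v, jneg v u] at h2
    linarith
  have q3 : apw (Jh v - u) (Jh (v - u_h)) ≤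
      ((1 + CJ) * nh (u - v)) * (κ * nh (v - u_h)) := by
    have h1 := qba_cs apw a1 a2 a3 a4 (Jh v - u) (Jh (v - u_h))
    rw [← hnpw, ← hnpw] at h1
    refine h1.trans (mul_le_mul q2 (hJk _ he) ?_ ?_)
    · rw [hnpw]; positivity
    · have := nn (u - v)
      positivity
  have q4 := hH v hv _ he
  have q5 : ah (v - u_h) (v - u_h) = ah v (v - u_h) - ah u_h (v - u_h) := by
    have := b1 (v - u_h) u_h (v - u_h)
    rw [sub_add_cancel] at this
    linarith
  have q6 : ah u_h (v - u_h) = apw u (Jh (v - u_h)) := by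
    rw [hFuh _ he, hFu _ (hJV _ he)]
  have q7 := hell _ he
  rw [asub] at q3
  have q8 : ΛH * nh (v - Jh v) * nh (v - u_h) ≤ ΛH * (CJ * nh (u - v)) * nh (v - u_h) := by
    have := nn (v - u_h)
    gcongr
  have q9 : nh (v - u_h) ≤ (ΛH * CJ + κ * (1 + CJ)) / α * nh (u - v) := by
    rw [div_mul_eq_mul_div, le_div_iff₀ hα]
    rcases (nn (v - u_h)).eq_or_lt with h0 | h0
    · rw [← h0]
      have := nn (u - v)
      simp only [zero_mul]
      positivity
    · refine le_of_mul_le_mul_right ?_ h0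
      linarith
  have q10 := tri (u - v) (v - u_h)
  rw [sub_add_sub_cancel] at q10
  linarith
end

section
/- Abstract error identity (Theorem 3.1). Assume the abstract framework and the Hilbert structure on V. Then for the exact solution u ∈ V (the Riesz representation of F) and any u_h ∈ V_h, the error identity ‖u − u_h‖_h² = (|||Res|||_*)² + inf_{v ∈ V} ‖v − u_h‖_h² holds, and the infimum on the right-hand side is attained by some v ∈ V. -/
theorem aux_disc (A c e : ℝ) (h : ∀ t : ℝ, 0 ≤ A * (t * t) + (2 * c) * t + e) :
    c ^ 2 ≤ A * e := by
  have := discrim_le_zero h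
  unfold discrim at this
  nlinarith

/-- **Abstract error identity (Theorem 3.1).**
Under the abstract framework with the Hilbert structure on `V` (the restriction `a` of
`apw` to `V` is positive definite and `(V, a)` is complete), for the exact solution
`u ∈ V` (the Riesz representation of the bounded linear functional `F`) and any
`u_h ∈ Vh`, the error identity
`‖u − u_h‖_h² = |||Res|||_*² + inf_{v ∈ V} ‖v − u_h‖_h²` holds with
`Res := F − apw(u_h, ·)|_V` and `|||Res|||_* = sup_{v ∈ V, v ≠ 0} Res(v)/|||v|||_pw`,
and the infimum on the right-hand side is attained by some `v₀ ∈ V`. -/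
theorem abstract_error_identity
    {X : Type*} [AddCommGroup X] [Module ℝ X]
    (apw jh : X → X → ℝ)
    (hapw_addl : ∀ x y z : X, apw (x + y) z = apw x z + apw y z)
    (hapw_smull : ∀ (c : ℝ) (x y : X), apw (c • x) y = c * apw x y)
    (hapw_symm : ∀ x y : X, apw x y = apw y x)
    (hapw_nonneg : ∀ x : X, 0 ≤ apw x x)
    (hjh_addl : ∀ x y z : X, jh (x + y) z = jh x z + jh y z)
    (hjh_smull : ∀ (c : ℝ) (x y : X), jh (c • x) y = c * jh x y)
    (hjh_symm : ∀ x y : X, jh x y = jh y x)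
    (hjh_nonneg : ∀ x : X, 0 ≤ jh x x)
    (V VM Vh : Submodule ℝ X)
    (hjh_vanish : ∀ v ∈ V ⊔ VM, ∀ w : X, jh v w = 0)
    (npw nh : X → ℝ)
    (hnpw_def : ∀ x : X, npw x = Real.sqrt (apw x x))
    (hnh_def : ∀ x : X, nh x = Real.sqrt (apw x x + jh x x))
    (hapw_posdef : ∀ v ∈ V, v ≠ 0 → 0 < apw v v)
    (hcomplete : ∀ f : ℕ → X, (∀ n : ℕ, f n ∈ V) →
      (∀ ε : ℝ, 0 < ε → ∃ N : ℕ, ∀ m ≥ N, ∀ n ≥ N, npw (f m - f n) < ε) →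
      ∃ x ∈ V, ∀ ε : ℝ, 0 < ε → ∃ N : ℕ, ∀ n ≥ N, npw (f n - x) < ε)
    (F : X →ₗ[ℝ] ℝ)
    (hFbdd : ∃ C : ℝ, ∀ v ∈ V, |F v| ≤ C * npw v)
    (u : X) (hu : u ∈ V) (huF : ∀ v ∈ V, apw u v = F v)
    (u_h : X) (huh : u_h ∈ Vh) :
    (∃ v₀ ∈ V, nh (v₀ - u_h) = ⨅ v : V, nh ((v : X) - u_h)) ∧
    nh (u - u_h) ^ 2 =
      (sSup {r : ℝ | ∃ v ∈ V, v ≠ 0 ∧ r = (F v - apw u_h v) / npw v}) ^ 2 +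
      (⨅ v : V, nh ((v : X) - u_h)) ^ 2 := by
  have addr : ∀ x y z : X, apw x (y + z) = apw x y + apw x z := by
    intro x y z
    rw [hapw_symm, hapw_addl, hapw_symm y, hapw_symm z]
  have smulr : ∀ (c : ℝ) (x y : X), apw x (c • y) = c * apw x y := by
    intro c x y
    rw [hapw_symm, hapw_smull, hapw_symm y]
  have subl : ∀ x y z : X, apw (x - y) z = apw x z - apw y z := by
    intro x y z
    have := hapw_addl (x - y) y z
    rw [sub_add_cancel] at this
    linarith
  have subr : ∀ x y z : X, apw x (y - z) = apw x y - apw x z := by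
    intro x y z
    rw [hapw_symm, subl, hapw_symm y, hapw_symm z]
  have npw_sq : ∀ x, npw x ^ 2 = apw x x := fun x => by
    rw [hnpw_def, Real.sq_sqrt (hapw_nonneg x)]
  have npw_nn : ∀ x, 0 ≤ npw x := fun x => by
    rw [hnpw_def]; exact Real.sqrt_nonneg _
  have cs2 : ∀ x y, apw x y ^ 2 ≤ apw y y * apw x x := by
    intro x y
    apply aux_disc
    intro t
    have h := hapw_nonneg (x + t • y)
    simp only [hapw_addl, hapw_smull, addr, smulr] at h
    rw [hapw_symm y x] at h
    linarith
  have cs : ∀ x y, apw x y ≤ npw x * npw y := by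
    intro x y
    refine le_trans (le_abs_self _) (abs_le_of_sq_le_sq ?_ (mul_nonneg (npw_nn x) (npw_nn y)))
    rw [mul_pow, npw_sq, npw_sq]
    linarith [cs2 x y]
  -- minimising sequence
  have key : ∃ w ∈ V, ∀ v ∈ V, apw (w - u_h) v = 0 := by
    let q : V → ℝ := fun v => apw ((v : X) - u_h) ((v : X) - u_h)
    have hbdd : BddBelow (Set.range q) := ⟨0, by rintro _ ⟨v, rfl⟩; exact hapw_nonneg _⟩
    have hd : ∀ v ∈ V, iInf q ≤ apw (v - u_h) (v - u_h) := fun v hv => ciInf_le hbdd ⟨v, hv⟩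
    have hex : ∀ n : ℕ, ∃ v : V, q v < iInf q + 1 / ((n : ℝ) + 1) := fun n =>
      exists_lt_of_ciInf_lt (lt_add_of_pos_right _ Nat.one_div_pos_of_nat)
    choose g hg using hex
    have hg' : ∀ n : ℕ, apw ((g n : X) - u_h) ((g n : X) - u_h) < iInf q + 1 / ((n : ℝ) + 1) := hg
    obtain ⟨w, hw, hlim⟩ := hcomplete (fun n => (g n : X)) (fun n => (g n).2) (by
      intro ε hε
      obtain ⟨N, hN⟩ := exists_nat_one_div_lt (show (0 : ℝ) < ε ^ 2 / 4 by positivity)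
      refine ⟨N, fun m hm n hn => ?_⟩
      apply lt_of_pow_lt_pow_left₀ 2 hε.le
      rw [npw_sq]
      have h1 := hg' m
      have h2 := hg' n
      have h3 := hd ((1 / 2 : ℝ) • ((g m : X) + g n)) (V.smul_mem _ (V.add_mem (g m).2 (g n).2))
      have h4 : 1 / ((m : ℝ) + 1) ≤ 1 / ((N : ℝ) + 1) := Nat.one_div_le_one_div hm
      have h5 : 1 / ((n : ℝ) + 1) ≤ 1 / ((N : ℝ) + 1) := Nat.one_div_le_one_div hn
      simp only [hapw_addl, hapw_smull, addr, smulr, subl, subr] at h1 h2 h3 ⊢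
      rw [hapw_symm u_h (g m)] at h1 h3
      rw [hapw_symm u_h (g n)] at h2 h3
      rw [hapw_symm (g n) (g m)] at h3 ⊢
      linarith)
    refine ⟨w, hw, fun v hv => ?_⟩
    by_contra hc
    set c := apw (w - u_h) v with hcdef
    have hc2 : 0 < c ^ 2 := by positivity
    have hA := hapw_nonneg v
    set A := apw v v with hAdef
    set δ := c ^ 2 / (4 * (A + 1)) with hδ
    have hδp : 0 < δ := by positivity
    obtain ⟨N1, hN1⟩ := exists_nat_one_div_lt hδp
    obtain ⟨N2, hN2⟩ := hlim (Real.sqrt δ) (Real.sqrt_pos.2 hδp)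
    let n := max N1 N2
    have h1 : 1 / ((n : ℝ) + 1) ≤ 1 / ((N1 : ℝ) + 1) := Nat.one_div_le_one_div (le_max_left _ _)
    have h2 := hN2 n (le_max_right _ _)
    have h3 : apw ((g n : X) - w) ((g n : X) - w) < δ := by
      rw [hnpw_def] at h2
      exact (Real.sqrt_lt_sqrt_iff (hapw_nonneg _)).1 h2
    have h4 : apw ((g n : X) - u_h) v ^ 2 ≤ A * (1 / ((n : ℝ) + 1)) := by
      apply aux_disc
      intro t
      have h5 := hd ((g n : X) + t • v) (V.add_mem (g n).2 (V.smul_mem _ hv))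
      have h6 := hg' n
      rw [add_sub_right_comm] at h5
      generalize (g n : X) - u_h = z at h5 h6 ⊢
      simp only [hapw_addl, hapw_smull, addr, smulr] at h5
      rw [hapw_symm v z] at h5
      linarith
    have h5 := cs2 ((g n : X) - w) v
    have h6 : c = apw ((g n : X) - u_h) v - apw ((g n : X) - w) v := by
      rw [hcdef]; simp only [subl]; ring
    have h7 : c ^ 2 ≤ 2 * apw ((g n : X) - u_h) v ^ 2 + 2 * apw ((g n : X) - w) v ^ 2 := by
      rw [h6]; nlinarith [sq_nonneg (apw ((g n : X) - u_h) v + apw ((g n : X) - w) v)]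
    have h8 : A * (1 / ((n : ℝ) + 1)) ≤ A * δ := mul_le_mul_of_nonneg_left (by linarith) hA
    have h9 : A * apw ((g n : X) - w) ((g n : X) - w) ≤ A * δ :=
      mul_le_mul_of_nonneg_left h3.le hA
    have h10 : c ^ 2 = 4 * (A + 1) * δ := by rw [hδ]; field_simp
    linarith
  obtain ⟨w, hw, horth⟩ := key
  have hj : ∀ v ∈ V, jh (v - u_h) (v - u_h) = jh u_h u_h := by
    intro v hv
    have e : v - u_h = v + (-1 : ℝ) • u_h := by rw [neg_one_smul, sub_eq_add_neg]
    have hv0 : ∀ z, jh v z = 0 := hjh_vanish v (Submodule.mem_sup_left hv)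
    rw [e, hjh_addl, hv0, hjh_smull, hjh_symm u_h, hjh_addl, hv0, hjh_smull]
    ring
  have pyth : ∀ v ∈ V, apw (v - u_h) (v - u_h) + jh (v - u_h) (v - u_h) =
      apw (v - w) (v - w) + (apw (w - u_h) (w - u_h) + jh (w - u_h) (w - u_h)) := by
    intro v hv
    rw [hj v hv, hj w hw]
    have h := horth (v - w) (V.sub_mem hv hw)
    have e : v - u_h = (v - w) + (w - u_h) := by abel
    rw [e, hapw_addl, addr, addr, hapw_symm (v - w) (w - u_h), h]
    ring
  have nh_sq : ∀ x, nh x ^ 2 = apw x x + jh x x := fun x => by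
    rw [hnh_def, Real.sq_sqrt (add_nonneg (hapw_nonneg x) (hjh_nonneg x))]
  have hinf : nh (w - u_h) = ⨅ v : V, nh ((v : X) - u_h) := by
    apply le_antisymm
    · apply le_ciInf
      intro v
      rw [hnh_def, hnh_def]
      apply Real.sqrt_le_sqrt
      rw [pyth v v.2]
      linarith [hapw_nonneg ((v : X) - w)]
    · exact ciInf_le (f := fun v : V => nh ((v : X) - u_h))
        ⟨0, by rintro _ ⟨v, rfl⟩; simp only [hnh_def]; exact Real.sqrt_nonneg _⟩ ⟨w, hw⟩
  have hres : ∀ v ∈ V, F v - apw u_h v = apw (u - w) v := by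
    intro v hv
    have := horth v hv
    rw [subl] at this
    rw [subl, huF v hv]
    linarith
  have hsup : sSup {r : ℝ | ∃ v ∈ V, v ≠ 0 ∧ r = (F v - apw u_h v) / npw v} = npw (u - w) := by
    have hub : ∀ r ∈ {r : ℝ | ∃ v ∈ V, v ≠ 0 ∧ r = (F v - apw u_h v) / npw v},
        r ≤ npw (u - w) := by
      rintro r ⟨v, hv, -, rfl⟩
      rw [hres v hv]
      exact div_le_of_le_mul₀ (npw_nn _) (npw_nn _) (cs _ _)
    by_cases h0 : u - w = 0
    · have hz : ∀ v, apw 0 v = 0 := fun v => by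
        have := hapw_smull 0 0 v
        simpa using this
      have hn : npw (u - w) = 0 := by rw [h0, hnpw_def, hz, Real.sqrt_zero]
      rw [hn]
      apply le_antisymm
      · exact Real.sSup_le (fun r hr => hn ▸ hub r hr) le_rfl
      · apply Real.sSup_nonneg
        rintro r ⟨v, hv, -, rfl⟩
        rw [hres v hv, h0, hz, zero_div]
    · refine IsGreatest.csSup_eq ⟨⟨u - w, V.sub_mem hu hw, h0, ?_⟩, hub⟩
      have hp := hapw_posdef _ (V.sub_mem hu hw) h0
      have hp' : npw (u - w) ≠ 0 := by
        rw [hnpw_def]; exact (Real.sqrt_pos.2 hp).ne'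
      rw [hres _ (V.sub_mem hu hw), ← npw_sq]
      field_simp
  refine ⟨⟨w, hw, hinf⟩, ?_⟩
  rw [hsup, ← hinf, nh_sq, nh_sq, npw_sq]
  exact pyth u hu
end

section
/- Key a posteriori inequality (24). Assume the abstract framework, the operators I_h, I_M, J with J_h := J ∘ I_M, the bilinear form a_h, property (H) with constant Λ_H, and the sources and solutions setup. Then, with e := u − J_h u_h ∈ V, e_h := I_h(I_M e) ∈ V_h, w := e − J_h e_h ∈ V and Res := F − a_pw(u_h, ·)|_V, one has |||e|||_pw² ≤ ( |||w|||_pw + Λ_H · ‖e_h‖_h ) · ‖u_h − J_h u_h‖_h + Res(w) + F̂(J_h e_h − Q e_h). -/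
/-- **Key a posteriori inequality (24).**
Under the abstract framework, with operators `Ih : VM → Vh`, `IM : X → VM`,
`J : VM → V`, `J_h := J ∘ IM`, a bilinear form `ah`, property (H) with constant
`ΛH`, sources `F : V → ℝ`, `F̂ : X → ℝ` with `F̂ = F` on `V`, a linear map
`Q : Vh → X`, the exact solution `u ∈ V` of `a(u, ·) = F` and the discrete
solution `u_h ∈ Vh` of `ah(u_h, ·) = F̂(Q ·)`, and with `e := u − J_h u_h ∈ V`,
`e_h := Ih(IM e) ∈ Vh`, `w := e − J_h e_h ∈ V`, `Res := F − apw(u_h, ·)|_V`,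
one has
`|||e|||² ≤ (|||w||| + ΛH ‖e_h‖_h) ‖u_h − J_h u_h‖_h + Res(w) + F̂(J_h e_h − Q e_h)`. -/
theorem key_aposteriori_inequality
    {X : Type*} [AddCommGroup X] [Module ℝ X]
    (apw jh : X → X → ℝ)
    (hapw_addl : ∀ x y z : X, apw (x + y) z = apw x z + apw y z)
    (hapw_smull : ∀ (c : ℝ) (x y : X), apw (c • x) y = c * apw x y)
    (hapw_symm : ∀ x y : X, apw x y = apw y x)
    (hapw_nonneg : ∀ x : X, 0 ≤ apw x x)
    (hjh_addl : ∀ x y z : X, jh (x + y) z = jh x z + jh y z)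
    (hjh_smull : ∀ (c : ℝ) (x y : X), jh (c • x) y = c * jh x y)
    (hjh_symm : ∀ x y : X, jh x y = jh y x)
    (hjh_nonneg : ∀ x : X, 0 ≤ jh x x)
    (V VM Vh : Submodule ℝ X)
    (hjh_vanish : ∀ v ∈ V ⊔ VM, ∀ w : X, jh v w = 0)
    (npw nh : X → ℝ)
    (hnpw_def : ∀ x : X, npw x = Real.sqrt (apw x x))
    (hnh_def : ∀ x : X, nh x = Real.sqrt (apw x x + jh x x))
    (Ih IM J : X →ₗ[ℝ] X)
    (hIh_maps : ∀ x ∈ VM, Ih x ∈ Vh)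
    (hIM_maps : ∀ x : X, IM x ∈ VM)
    (hJ_maps : ∀ x ∈ VM, J x ∈ V)
    (ah : X → X → ℝ)
    (hah_addl : ∀ x y z : X, ah (x + y) z = ah x z + ah y z)
    (hah_smull : ∀ (c : ℝ) (x y : X), ah (c • x) y = c * ah x y)
    (hah_addr : ∀ x y z : X, ah x (y + z) = ah x y + ah x z)
    (hah_smulr : ∀ (c : ℝ) (x y : X), ah x (c • y) = c * ah x y)
    (ΛH : ℝ) (hΛH : 0 ≤ ΛH)
    (hH : ∀ wh ∈ Vh, ∀ vh ∈ Vh,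
      ah wh vh - apw (J (IM wh)) (J (IM vh)) ≤ ΛH * nh (wh - J (IM wh)) * nh vh)
    (F Fhat : X →ₗ[ℝ] ℝ)
    (hFagree : ∀ v ∈ V, Fhat v = F v)
    (Q : X →ₗ[ℝ] X)
    (u : X) (hu : u ∈ V) (huF : ∀ v ∈ V, apw u v = F v)
    (u_h : X) (huh : u_h ∈ Vh)
    (huh_eq : ∀ vh ∈ Vh, ah u_h vh = Fhat (Q vh)) :
    ∀ e eh w : X,
      e = u - J (IM u_h) → eh = Ih (IM e) → w = e - J (IM eh) →
      npw e ^ 2 ≤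
        (npw w + ΛH * nh eh) * nh (u_h - J (IM u_h))
          + (F w - apw u_h w) + Fhat (J (IM eh) - Q eh) := by
  intro e eh w he heh hw
  have subl : ∀ x y z : X, apw (x - y) z = apw x z - apw y z := by
    intro x y z
    have h := hapw_addl (x - y) y z
    rw [sub_add_cancel] at h
    linarith
  have addr : ∀ x y z : X, apw x (y + z) = apw x y + apw x z := by
    intro x y z
    rw [hapw_symm, hapw_addl, hapw_symm y, hapw_symm z]
  have smulr : ∀ (c : ℝ) (x y : X), apw x (c • y) = c * apw x y := by
    intro c x y
    rw [hapw_symm, hapw_smull, hapw_symm]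
  -- Cauchy-Schwarz for the semi-inner product
  have cs : ∀ x y : X, apw x y ≤ Real.sqrt (apw x x) * Real.sqrt (apw y y) := by
    intro x y
    have hq : ∀ t : ℝ, 0 ≤ apw y y * (t * t) + (2 * apw x y) * t + apw x x := by
      intro t
      have h := hapw_nonneg (x + t • y)
      rw [hapw_addl, addr, addr, hapw_smull, hapw_smull, smulr, smulr, hapw_symm y x] at h
      linarith
    have hd := discrim_le_zero hq
    rw [discrim] at hd
    rw [← Real.sqrt_mul (hapw_nonneg x)]
    apply Real.le_sqrt_of_sq_le
    linarith
  have hehV : eh ∈ Vh := heh ▸ hIh_maps _ (hIM_maps _)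
  have hp : J (IM u_h) ∈ V := hJ_maps _ (hIM_maps _)
  have hqV : J (IM eh) ∈ V := hJ_maps _ (hIM_maps _)
  have heV : e ∈ V := he ▸ V.sub_mem hu hp
  have hH' := hH u_h huh eh hehV
  rw [huh_eq eh hehV] at hH'
  have hCS : apw (u_h - J (IM u_h)) w ≤ npw w * nh (u_h - J (IM u_h)) := by
    refine (cs _ _).trans ?_
    rw [hnpw_def, hnh_def, mul_comm]
    refine mul_le_mul_of_nonneg_left (Real.sqrt_le_sqrt ?_) (Real.sqrt_nonneg _)
    linarith [hjh_nonneg (u_h - J (IM u_h))]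
  have hsq : npw e ^ 2 = apw e e := by rw [hnpw_def, Real.sq_sqrt (hapw_nonneg e)]
  have h1 : apw e e = F e - apw (J (IM u_h)) e := by
    rw [← huF e heV, ← subl, ← he]
  have hew : e = w + J (IM eh) := by rw [hw, sub_add_cancel]
  have h2 : F e = F w + F (J (IM eh)) := by rw [← map_add, ← hew]
  have h3 : apw (J (IM u_h)) e = apw (J (IM u_h)) w + apw (J (IM u_h)) (J (IM eh)) := by
    rw [← addr, ← hew]
  rw [subl] at hCS
  rw [hsq, h1, h2, h3, map_sub, hFagree _ hqV]
  linarith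
end
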